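/- If R_1 ↦ R_2 is an exchange move or a type →II stabilization or destabilization of rectangular diagrams of a link, then the homology classes of Γ_→II(R_1) and Γ_→II(R_2) in H_1(T^2; Z) coincide. -/

import Mathlib

open Set

noncomputable section

/-- The circle `S¹`, modeled as `ℝ/ℤ`. -/
abbrev 𝕊 : Type := AddCircle (1 : ℝ)

/-- The torus `T² = S¹ × S¹`. -/
abbrev Torus : Type := 𝕊 × 𝕊

instance : Fact ((0:ℝ) < 1) := ⟨one_pos⟩

/-- The representative of a point of `S¹` in `[0,1)`. -/
noncomputable def toIco (x : 𝕊) : ℝ := (AddCircle.equivIco 1 0 x).1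

/-- The closed positively oriented arc `[a;b]` in `S¹`. -/
def closedArc (a b : 𝕊) : Set 𝕊 := {x | toIco (x - a) ≤ toIco (b - a)}

/-- The open positively oriented arc `(a;b)` in `S¹`. -/
def openArc (a b : 𝕊) : Set 𝕊 := {x | 0 < toIco (x - a) ∧ toIco (x - a) < toIco (b - a)}

/-- An oriented rectangular diagram of a link. -/
structure RectDiagram where
  pos : Finset Torus
  neg : Finset Torus
  disj : Disjoint pos neg
  nonempty : (pos ∪ neg).Nonempty
  thetaEq : pos.image Prod.fst = neg.image Prod.fst
  phiEq : pos.image Prod.snd = neg.image Prod.snd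
  thetaInjPos : Set.InjOn Prod.fst (pos : Set Torus)
  thetaInjNeg : Set.InjOn Prod.fst (neg : Set Torus)
  phiInjPos : Set.InjOn Prod.snd (pos : Set Torus)
  phiInjNeg : Set.InjOn Prod.snd (neg : Set Torus)

namespace RectDiagram

/-- The set of vertices of a rectangular diagram. -/
def verts (R : RectDiagram) : Finset Torus := R.pos ∪ R.neg

/-- The projection of the vertex set to the `θ`-circle. -/
def pθ (R : RectDiagram) : Finset 𝕊 := R.verts.image Prod.fst

/-- The projection of the vertex set to the `φ`-circle. -/
def pφ (R : RectDiagram) : Finset 𝕊 := R.verts.image Prod.snd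

/-- Vertical edges: unordered pairs of distinct vertices with equal `θ`-coordinate. -/
def vertEdges (R : RectDiagram) : Set (Finset Torus) :=
  {e | ∃ u ∈ R.verts, ∃ v ∈ R.verts, u ≠ v ∧ u.1 = v.1 ∧ e = {u, v}}

/-- Horizontal edges: unordered pairs of distinct vertices with equal `φ`-coordinate. -/
def horizEdges (R : RectDiagram) : Set (Finset Torus) :=
  {e | ∃ u ∈ R.verts, ∃ v ∈ R.verts, u ≠ v ∧ u.2 = v.2 ∧ e = {u, v}}

end RectDiagram

/-- A set of one, two, or three consecutive corners of the rectangle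
`[θ₁;θ₂] × [φ₁;φ₂]` (in the cyclic order of the corners). -/
def ConsecCorners (θ₁ θ₂ φ₁ φ₂ : 𝕊) (s : Set Torus) : Prop :=
  let c₁ : Torus := (θ₁, φ₁); let c₂ : Torus := (θ₂, φ₁)
  let c₃ : Torus := (θ₂, φ₂); let c₄ : Torus := (θ₁, φ₂)
  s = {c₁} ∨ s = {c₂} ∨ s = {c₃} ∨ s = {c₄} ∨
  s = {c₁, c₂} ∨ s = {c₂, c₃} ∨ s = {c₃, c₄} ∨ s = {c₄, c₁} ∨
  s = {c₁, c₂, c₃} ∨ s = {c₂, c₃, c₄} ∨ s = {c₃, c₄, c₁} ∨ s = {c₄, c₁, c₂}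

/-- An elementary move `R₁ ↦ R₂` with the given data `θ₁, θ₂, φ₁, φ₂`. -/
def ElemMoveData (R₁ R₂ : RectDiagram) (θ₁ θ₂ φ₁ φ₂ : 𝕊) : Prop :=
  θ₁ ≠ θ₂ ∧ φ₁ ≠ φ₂ ∧
  symmDiff (↑R₁.verts : Set Torus) ↑R₂.verts = ({θ₁, θ₂} : Set 𝕊) ×ˢ ({φ₁, φ₂} : Set 𝕊) ∧
  (closedArc θ₁ θ₂ ×ˢ closedArc φ₁ φ₂) ∩ ((↑R₁.verts : Set Torus) ∪ ↑R₂.verts)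
    = symmDiff (↑R₁.verts : Set Torus) ↑R₂.verts ∧
  (∃ s : Set Torus, ConsecCorners θ₁ θ₂ φ₁ φ₂ s ∧
    (↑R₁.verts : Set Torus) ∩ (({θ₁, θ₂} : Set 𝕊) ×ˢ ({φ₁, φ₂} : Set 𝕊)) = s ∧
    (({θ₁, θ₂} : Set 𝕊) ×ˢ ({φ₁, φ₂} : Set 𝕊)) \ s ⊆ (↑R₂.verts : Set Torus)) ∧
  ((↑R₁.pos : Set Torus) ∩ ↑R₂.verts = (↑R₁.verts : Set Torus) ∩ ↑R₂.pos)

/-- An elementary move of rectangular diagrams. -/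
def ElemMove (R₁ R₂ : RectDiagram) : Prop :=
  ∃ θ₁ θ₂ φ₁ φ₂, ElemMoveData R₁ R₂ θ₁ θ₂ φ₁ φ₂

/-- An exchange move. -/
def ExchangeMove (R₁ R₂ : RectDiagram) : Prop :=
  ElemMove R₁ R₂ ∧ R₁.verts.card = R₂.verts.card

/-- A stabilization move. -/
def Stab (R₁ R₂ : RectDiagram) : Prop :=
  ElemMove R₁ R₂ ∧ R₂.verts.card = R₁.verts.card + 2

/-- A destabilization move. -/
def Destab (R₁ R₂ : RectDiagram) : Prop :=
  ElemMove R₁ R₂ ∧ R₁.verts.card = R₂.verts.card + 2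

/-- The four oriented types of stabilizations: `→I`, `←I`, `→II`, `←II`. -/
inductive OType | rI | lI | rII | lII
deriving DecidableEq

/-- A stabilization `R₁ ↦ R₂` with data `θ₁, θ₂, φ₁, φ₂` has oriented type `T`:
`v` is the (unique) vertex of `R₁` in the rectangle, type I means
`v ∈ {(θ₁,φ₁),(θ₂,φ₂)}`, type II means `v ∈ {(θ₁,φ₂),(θ₂,φ₁)}`, and the arrow is
`→` or `←` according to the sign of `(θ₂,φ₀)` in `R₂`, where
`{θ₁,θ₂} × {φ₀} ⊆ R₂`. -/
def StabTypeData (R₁ R₂ : RectDiagram) (θ₁ θ₂ φ₁ φ₂ : 𝕊) (T : OType) : Prop :=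
  ∃ v ∈ (↑R₁.verts : Set Torus) ∩ (closedArc θ₁ θ₂ ×ˢ closedArc φ₁ φ₂),
    ∃ φ₀ ∈ ({φ₁, φ₂} : Set 𝕊), (θ₁, φ₀) ∈ R₂.verts ∧ (θ₂, φ₀) ∈ R₂.verts ∧
    (match T with
     | .rI => (v = (θ₁, φ₁) ∨ v = (θ₂, φ₂)) ∧ (θ₂, φ₀) ∈ R₂.pos
     | .lI => (v = (θ₁, φ₁) ∨ v = (θ₂, φ₂)) ∧ (θ₂, φ₀) ∈ R₂.neg
     | .rII => (v = (θ₁, φ₂) ∨ v = (θ₂, φ₁)) ∧ (θ₂, φ₀) ∈ R₂.pos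
     | .lII => (v = (θ₁, φ₂) ∨ v = (θ₂, φ₁)) ∧ (θ₂, φ₀) ∈ R₂.neg)

/-- A stabilization of oriented type `T`. -/
def StabOfType (R₁ R₂ : RectDiagram) (T : OType) : Prop :=
  ∃ θ₁ θ₂ φ₁ φ₂, ElemMoveData R₁ R₂ θ₁ θ₂ φ₁ φ₂ ∧
    R₂.verts.card = R₁.verts.card + 2 ∧ StabTypeData R₁ R₂ θ₁ θ₂ φ₁ φ₂ T

/-- A destabilization of oriented type `T` (the type is read off from the inverse
stabilization `R₂ ↦ R₁`). -/
def DestabOfType (R₁ R₂ : RectDiagram) (T : OType) : Prop :=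
  ∃ θ₁ θ₂ φ₁ φ₂, ElemMoveData R₁ R₂ θ₁ θ₂ φ₁ φ₂ ∧
    R₁.verts.card = R₂.verts.card + 2 ∧ StabTypeData R₂ R₁ θ₁ θ₂ φ₁ φ₂ T

/-- The union of staircase curves `Γ_→II(R)` on the torus. -/
def Gamma (R : RectDiagram) : Set Torus :=
  {p | ∃ θ₀ φ₁ φ₂, (θ₀, φ₁) ∈ R.pos ∧ (θ₀, φ₂) ∈ R.neg ∧ p.1 = θ₀ ∧ p.2 ∈ closedArc φ₁ φ₂} ∪
  {p | ∃ θ₁ θ₂ φ₀, (θ₁, φ₀) ∈ R.neg ∧ (θ₂, φ₀) ∈ R.pos ∧ p.2 = φ₀ ∧ p.1 ∈ closedArc θ₁ θ₂}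

/-- Number of intersection points of a subset of the torus with the meridian `{θ₀} × S¹`. -/
def merCount (A : Set Torus) (θ₀ : 𝕊) : ℕ := (A ∩ {p | p.1 = θ₀}).ncard

/-- Number of intersection points of a subset of the torus with the longitude `S¹ × {φ₀}`. -/
def lonCount (A : Set Torus) (φ₀ : 𝕊) : ℕ := (A ∩ {p | p.2 = φ₀}).ncard

/-- `(k,l)` is the homology class of `Γ_→II(R)` in `H₁(T²;ℤ)`: it counts the
intersections of `Γ_→II(R)` with generic meridians and longitudes respectively. -/
def IsHomClass (R : RectDiagram) (k l : ℕ) : Prop :=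
  (∀ θ₀ : 𝕊, θ₀ ∉ R.pθ → merCount (Gamma R) θ₀ = k) ∧
  (∀ φ₀ : 𝕊, φ₀ ∉ R.pφ → lonCount (Gamma R) φ₀ = l)

/-- `p` lies in the relative interior of a vertical segment of `Γ_→II(R)`. -/
def OnVertInt (R : RectDiagram) (p : Torus) : Prop :=
  ∃ θ₀ φ₁ φ₂, (θ₀, φ₁) ∈ R.pos ∧ (θ₀, φ₂) ∈ R.neg ∧ p.1 = θ₀ ∧ p.2 ∈ openArc φ₁ φ₂

/-- `p` lies in the relative interior of a horizontal segment of `Γ_→II(R)`. -/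
def OnHorizInt (R : RectDiagram) (p : Torus) : Prop :=
  ∃ θ₁ θ₂ φ₀, (θ₁, φ₀) ∈ R.neg ∧ (θ₂, φ₀) ∈ R.pos ∧ p.2 = φ₀ ∧ p.1 ∈ openArc θ₁ θ₂

/-- The set of double (self-intersection) points of `Γ_→II(R)`. -/
def DoublePts (R : RectDiagram) : Set Torus := {p | OnVertInt R p ∧ OnHorizInt R p}

/-- An exchange move or a type-`T` stabilization or destabilization. -/
def MoveOfType (T : OType) (R₁ R₂ : RectDiagram) : Prop :=
  ExchangeMove R₁ R₂ ∨ StabOfType R₁ R₂ T ∨ DestabOfType R₁ R₂ T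

/-- The equivalence generated by exchange moves and type-`T` (de)stabilizations:
`[R₁]_T = [R₂]_T`. -/
def EquivOfType (T : OType) : RectDiagram → RectDiagram → Prop :=
  Relation.ReflTransGen (MoveOfType T)

/-- An (ambient) isotopy of the torus: a continuous family of homeomorphisms
starting from the identity. -/
def Isotopy (H : ℝ → Torus ≃ₜ Torus) : Prop :=
  Continuous (fun q : ℝ × Torus => H q.1 q.2) ∧ H 0 = Homeomorph.refl Torus

/-- `A` is isotopic to `B` by an ambient isotopy of `T²` fixed on `X`. -/
def IsotopicRelFixed (A B X : Set Torus) : Prop :=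
  ∃ H : ℝ → Torus ≃ₜ Torus, Isotopy H ∧ (∀ t : ℝ, ∀ x ∈ X, H t x = x) ∧ (H 1) '' A = B

/-- `F` is an embedded closed disc in the torus. -/
def IsClosedDisc (F : Set Torus) : Prop :=
  Nonempty (↥F ≃ₜ ↥(Metric.closedBall (0 : ℝ × ℝ) 1))

/-- `F` is an embedded closed annulus in the torus. -/
def IsClosedAnnulus (F : Set Torus) : Prop :=
  Nonempty (↥F ≃ₜ (𝕊 × ↥(Set.Icc (0:ℝ) 1)))

/-- A self-homeomorphism of `S¹` is orientation-preserving if it preserves the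
cyclic order (sends points of open positively oriented arcs to points of the
corresponding open positively oriented arcs). -/
def OrientPres (f : 𝕊 ≃ₜ 𝕊) : Prop :=
  ∀ a b c : 𝕊, b ∈ openArc a c → f b ∈ openArc (f a) (f c)

/-- Combinatorial equivalence of rectangular diagrams: related by a product of
orientation-preserving self-homeomorphisms of the two circle factors. -/
def CombEquiv (R R' : RectDiagram) : Prop :=
  ∃ f g : 𝕊 ≃ₜ 𝕊, OrientPres f ∧ OrientPres g ∧
    (fun p : Torus => (f p.1, g p.2)) '' ↑R.pos = ↑R'.pos ∧
    (fun p : Torus => (f p.1, g p.2)) '' ↑R.neg = ↑R'.neg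

/-- `R` and `R'` have the same `→II`-homology type. -/
def SameHomType (R R' : RectDiagram) : Prop :=
  ∃ R'' : RectDiagram, CombEquiv R' R'' ∧
    IsotopicRelFixed (Gamma R) (Gamma R'') (DoublePts R)

/-! ### Helper lemmas -/

lemma toIco_nonneg (x : 𝕊) : 0 ≤ toIco x := (AddCircle.equivIco 1 0 x).2.1

lemma toIco_lt_one (x : 𝕊) : toIco x < 1 := by
  have := (AddCircle.equivIco 1 0 x).2.2
  simpa [toIco] using this

lemma coe_toIco (x : 𝕊) : ((toIco x : ℝ) : 𝕊) = x :=
  (AddCircle.equivIco 1 0).symm_apply_apply x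

lemma toIco_coe {t : ℝ} (h0 : 0 ≤ t) (h1 : t < 1) : toIco (t : 𝕊) = t := by
  have := (AddCircle.equivIco (1:ℝ) 0).apply_symm_apply ⟨t, by simpa using ⟨h0, h1⟩⟩
  exact congrArg Subtype.val this

lemma toIco_inj {x y : 𝕊} (h : toIco x = toIco y) : x = y := by
  rw [← coe_toIco x, ← coe_toIco y, h]

lemma toIco_sub_of_le {x y : 𝕊} (h : toIco y ≤ toIco x) : toIco (x - y) = toIco x - toIco y := by
  have : x - y = ((toIco x - toIco y : ℝ) : 𝕊) := by
    rw [AddCircle.coe_sub, coe_toIco, coe_toIco]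
  rw [this]
  exact toIco_coe (by linarith) (by linarith [toIco_lt_one x, toIco_nonneg y])

lemma toIco_sub_of_lt {x y : 𝕊} (h : toIco x < toIco y) :
    toIco (x - y) = toIco x - toIco y + 1 := by
  have : x - y = ((toIco x - toIco y + 1 : ℝ) : 𝕊) := by
    rw [AddCircle.coe_add, AddCircle.coe_period, add_zero, AddCircle.coe_sub, coe_toIco, coe_toIco]
  rw [this]
  exact toIco_coe (by linarith [toIco_lt_one y, toIco_nonneg x]) (by linarith)

lemma toIco_sub_base (a b c : 𝕊) :
    toIco (b - a) = toIco (b - c) - toIco (a - c) +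
      (if toIco (b - c) < toIco (a - c) then 1 else 0) := by
  have e : b - a = (b - c) - (a - c) := by abel
  rw [e]
  split_ifs with h
  · exact toIco_sub_of_lt h
  · rw [toIco_sub_of_le (not_lt.mp h), add_zero]

lemma toIco_zero : toIco 0 = 0 := by
  have := toIco_coe (t := 0) le_rfl one_pos
  simpa using this

lemma toIco_pos {x : 𝕊} (h : x ≠ 0) : 0 < toIco x := by
  rcases (toIco_nonneg x).lt_or_eq with h' | h'
  · exact h'
  · exact absurd (toIco_inj (h'.symm.trans toIco_zero.symm)) h

lemma mem_closedArc_iff {a b c : 𝕊} (ha : a ≠ c) :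
    c ∈ closedArc a b ↔ toIco (b - c) < toIco (a - c) := by
  have h1 : 0 < toIco (a - c) := toIco_pos (sub_ne_zero.mpr ha)
  have h2 := toIco_sub_base a c c
  rw [sub_self, toIco_zero, if_pos h1] at h2
  have h3 := toIco_sub_base a b c
  have h4 := toIco_lt_one (b - c)
  simp only [closedArc, Set.mem_ofPred_eq]
  split_ifs at h3 with h
  · simp only [h, iff_true]; linarith [toIco_nonneg (b - c)]
  · simp only [h, iff_false]; linarith

lemma exists_generic (a b : 𝕊) (F : Finset 𝕊) : ∃ c, c ∉ closedArc a b ∧ c ∉ F := by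
  have hinf : (Set.Ioo (toIco (b - a)) 1).Infinite := Set.Ioo_infinite (toIco_lt_one _)
  have hinj : Set.InjOn (fun t : ℝ => a + (t : 𝕊)) (Set.Ioo (toIco (b - a)) 1) := by
    intro s hs t ht hst
    have h0 := toIco_nonneg (b - a)
    have : (s : 𝕊) = (t : 𝕊) := add_left_cancel hst
    rw [← toIco_coe (t := s) (by linarith [hs.1]) hs.2, this,
      toIco_coe (by linarith [ht.1]) ht.2]
  obtain ⟨c, ⟨t, ht, rfl⟩, hc⟩ := (hinf.image hinj).exists_notMem_finset F
  refine ⟨_, ?_, hc⟩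
  have h0 := toIco_nonneg (b - a)
  simp only [closedArc, Set.mem_ofPred_eq, add_sub_cancel_left, not_le]
  rw [toIco_coe (by linarith [ht.1]) ht.2]
  exact ht.1

/-- Relative position of a point outside an arc, seen from another point outside the arc. -/
lemma arc_side {a b c z : 𝕊} (hab : a ≠ b) (hc : c ∉ closedArc a b) (hca : a ≠ c)
    (hz : z ∉ closedArc a b) :
    toIco (a - c) < toIco (b - c) ∧
      (toIco (z - c) < toIco (a - c) ∨ toIco (b - c) < toIco (z - c)) := by
  rw [mem_closedArc_iff hca, not_lt] at hc
  have h1 : toIco (a - c) < toIco (b - c) := by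
    refine lt_of_le_of_ne hc fun h => hab ?_
    exact sub_left_injective (toIco_inj h)
  refine ⟨h1, ?_⟩
  by_contra hcon
  push Not at hcon
  apply hz
  have h3 := toIco_sub_base a b c
  have h4 := toIco_sub_base a z c
  rw [if_neg (by linarith)] at h3
  rw [if_neg (by linarith [hcon.1])] at h4
  simp only [closedArc, Set.mem_ofPred_eq]
  linarith [hcon.2]

namespace RectDiagram

lemma mem_verts (R : RectDiagram) (p : Torus) : p ∈ R.verts ↔ p ∈ R.pos ∨ p ∈ R.neg := by
  simp [verts]

lemma not_both (R : RectDiagram) {p : Torus} (h : p ∈ R.pos) (h' : p ∈ R.neg) : False :=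
  Finset.disjoint_left.mp R.disj h h'

lemma exists_phi (R : RectDiagram) (x : 𝕊) : (∃ y, (y, x) ∈ R.pos) ↔ (∃ y, (y, x) ∈ R.neg) := by
  have h := Finset.ext_iff.mp R.phiEq x
  simpa using h

lemma exists_theta (R : RectDiagram) (x : 𝕊) :
    (∃ y, (x, y) ∈ R.pos) ↔ (∃ y, (x, y) ∈ R.neg) := by
  have h := Finset.ext_iff.mp R.thetaEq x
  simpa using h

lemma posRow (R : RectDiagram) {a b y : 𝕊} (h : (a, y) ∈ R.pos) (h' : (b, y) ∈ R.pos) : a = b :=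
  congrArg Prod.fst (R.phiInjPos h h' rfl)

lemma negRow (R : RectDiagram) {a b y : 𝕊} (h : (a, y) ∈ R.neg) (h' : (b, y) ∈ R.neg) : a = b :=
  congrArg Prod.fst (R.phiInjNeg h h' rfl)

lemma posCol (R : RectDiagram) {a b y : 𝕊} (h : (y, a) ∈ R.pos) (h' : (y, b) ∈ R.pos) : a = b :=
  congrArg Prod.snd (R.thetaInjPos h h' rfl)

lemma negCol (R : RectDiagram) {a b y : 𝕊} (h : (y, a) ∈ R.neg) (h' : (y, b) ∈ R.neg) : a = b :=
  congrArg Prod.snd (R.thetaInjNeg h h' rfl)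

/-- The reflected diagram: swap both the coordinates and the signs. -/
def tr (R : RectDiagram) : RectDiagram where
  pos := R.neg.map (Equiv.prodComm 𝕊 𝕊).toEmbedding
  neg := R.pos.map (Equiv.prodComm 𝕊 𝕊).toEmbedding
  disj := by
    rw [Finset.disjoint_map]
    exact R.disj.symm
  nonempty := by
    obtain ⟨p, hp⟩ := R.nonempty
    refine ⟨p.swap, ?_⟩
    rw [Finset.mem_union] at hp ⊢
    rcases hp with hp | hp
    · right; simpa using hp
    · left; simpa using hp
  thetaEq := by
    ext x
    have := R.exists_phi x
    simp [this]
  phiEq := by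
    ext x
    have := R.exists_theta x
    simp [this]
  thetaInjPos := by
    rintro ⟨a, b⟩ h ⟨a', b'⟩ h' e
    simp only [Finset.coe_map, Set.mem_image, Finset.mem_coe] at h h' e
    subst e
    obtain ⟨⟨u, v⟩, h, e⟩ := h
    obtain ⟨⟨u', v'⟩, h', e'⟩ := h'
    simp at e e'
    obtain ⟨rfl, rfl⟩ := e
    obtain ⟨rfl, rfl⟩ := e'
    rw [R.negRow h h']
  thetaInjNeg := by
    rintro ⟨a, b⟩ h ⟨a', b'⟩ h' e
    simp only [Finset.coe_map, Set.mem_image, Finset.mem_coe] at h h' e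
    subst e
    obtain ⟨⟨u, v⟩, h, e⟩ := h
    obtain ⟨⟨u', v'⟩, h', e'⟩ := h'
    simp at e e'
    obtain ⟨rfl, rfl⟩ := e
    obtain ⟨rfl, rfl⟩ := e'
    rw [R.posRow h h']
  phiInjPos := by
    rintro ⟨a, b⟩ h ⟨a', b'⟩ h' e
    simp only [Finset.coe_map, Set.mem_image, Finset.mem_coe] at h h' e
    subst e
    obtain ⟨⟨u, v⟩, h, e⟩ := h
    obtain ⟨⟨u', v'⟩, h', e'⟩ := h'
    simp at e e'
    obtain ⟨rfl, rfl⟩ := e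
    obtain ⟨rfl, rfl⟩ := e'
    rw [R.negCol h h']
  phiInjNeg := by
    rintro ⟨a, b⟩ h ⟨a', b'⟩ h' e
    simp only [Finset.coe_map, Set.mem_image, Finset.mem_coe] at h h' e
    subst e
    obtain ⟨⟨u, v⟩, h, e⟩ := h
    obtain ⟨⟨u', v'⟩, h', e'⟩ := h'
    simp at e e'
    obtain ⟨rfl, rfl⟩ := e
    obtain ⟨rfl, rfl⟩ := e'
    rw [R.posCol h h']

lemma mem_tr_pos (R : RectDiagram) (a b : 𝕊) : (a, b) ∈ R.tr.pos ↔ (b, a) ∈ R.neg := by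
  simp [tr]

lemma mem_tr_neg (R : RectDiagram) (a b : 𝕊) : (a, b) ∈ R.tr.neg ↔ (b, a) ∈ R.pos := by
  simp [tr]

lemma mem_tr_verts (R : RectDiagram) (a b : 𝕊) : (a, b) ∈ R.tr.verts ↔ (b, a) ∈ R.verts := by
  rw [mem_verts, mem_verts, mem_tr_pos, mem_tr_neg, or_comm]

lemma mem_pθ (R : RectDiagram) (x : 𝕊) : x ∈ R.pθ ↔ ∃ y, (x, y) ∈ R.verts := by
  simp [pθ]

lemma mem_pφ (R : RectDiagram) (x : 𝕊) : x ∈ R.pφ ↔ x ∈ R.tr.pθ := by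
  rw [mem_pθ]; simp [pφ, mem_tr_verts]

/-- The rows whose horizontal segment crosses the meridian over `c`. -/
def Row (R : RectDiagram) (c y : 𝕊) : Prop :=
  ∃ a b, (a, y) ∈ R.neg ∧ (b, y) ∈ R.pos ∧ toIco (b - c) < toIco (a - c)

open Classical in
/-- The angular coordinate of the negative vertex in a given row. -/
def negθ (R : RectDiagram) (y : 𝕊) : 𝕊 :=
  if h : ∃ a, (a, y) ∈ R.neg then h.choose else 0

lemma negθ_eq (R : RectDiagram) {a y : 𝕊} (h : (a, y) ∈ R.neg) : R.negθ y = a := by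
  have h' : ∃ a, (a, y) ∈ R.neg := ⟨a, h⟩
  rw [negθ, dif_pos h']
  exact R.negRow h'.choose_spec h

lemma negθ_mem (R : RectDiagram) {p : Torus} (h : p ∈ R.pos) : (R.negθ p.2, p.2) ∈ R.neg := by
  obtain ⟨a, ha⟩ := (R.exists_phi p.2).mp ⟨p.1, h⟩
  rwa [R.negθ_eq ha]

/-- Total horizontal length. -/
def len (R : RectDiagram) : ℝ := ∑ p ∈ R.pos, toIco (p.1 - R.negθ p.2)

lemma sum_neg (R : RectDiagram) (f : 𝕊 → ℝ) :
    ∑ p ∈ R.pos, f (R.negθ p.2) = ∑ p ∈ R.pos, f p.1 := by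
  have h1 : ∑ p ∈ R.pos, f (R.negθ p.2) = ∑ p ∈ R.neg, f (R.negθ p.2) := by
    rw [← Finset.sum_image (f := fun y => f (R.negθ y)) R.phiInjPos,
      ← Finset.sum_image (f := fun y => f (R.negθ y)) R.phiInjNeg, R.phiEq]
  rw [h1, ← Finset.sum_image (f := f) R.thetaInjPos, R.thetaEq, Finset.sum_image R.thetaInjNeg]
  refine Finset.sum_congr rfl fun p hp => ?_
  rw [R.negθ_eq (a := p.1) hp]

lemma len_eq (R : RectDiagram) (c : 𝕊) : R.len = ({y | R.Row c y}.ncard : ℝ) := by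
  classical
  have hset : {y | R.Row c y} =
      ((R.pos.filter fun p => toIco (p.1 - c) < toIco (R.negθ p.2 - c)).image Prod.snd :
        Finset 𝕊) := by
    ext y
    simp only [Row, Set.mem_ofPred_eq, Finset.coe_image, Finset.coe_filter, Set.mem_image]
    constructor
    · rintro ⟨a, b, ha, hb, h⟩
      exact ⟨(b, y), ⟨hb, by rw [R.negθ_eq ha]; exact h⟩, rfl⟩
    · rintro ⟨p, ⟨hp, h⟩, rfl⟩
      exact ⟨_, p.1, R.negθ_mem hp, hp, h⟩
  rw [hset, Set.ncard_coe_finset, Finset.card_image_of_injOn, Finset.card_filter, len]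
  · push_cast
    have h := R.sum_neg fun x => toIco (x - c)
    simp_rw [fun p : Torus => toIco_sub_base (R.negθ p.2) p.1 c]
    rw [Finset.sum_add_distrib, Finset.sum_sub_distrib, h, sub_self, zero_add]
  · exact R.phiInjPos.mono (by intro p hp; simp at hp; exact hp.1)

lemma merCount_eq (R : RectDiagram) (c : 𝕊) (hc : c ∉ R.pθ) :
    (merCount (Gamma R) c : ℝ) = R.len := by
  rw [R.len_eq c, merCount]
  congr 1
  have : Gamma R ∩ {p | p.1 = c} = (fun y => (c, y)) '' {y | R.Row c y} := by
    rw [mem_pθ] at hc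
    push Not at hc
    ext ⟨x, y⟩
    simp only [Gamma, Row, Set.mem_inter_iff, Set.mem_union, Set.mem_ofPred_eq, Set.mem_image,
      Prod.mk.injEq]
    constructor
    · rintro ⟨h | h, rfl⟩
      · obtain ⟨_, φ, _, h1, _, rfl, _⟩ := h
        exact absurd ((R.mem_verts _).mpr (Or.inl h1)) (hc φ)
      · obtain ⟨a, b, _, h1, h2, rfl, h3⟩ := h
        refine ⟨y, ⟨a, b, h1, h2, ?_⟩, rfl, rfl⟩
        rwa [mem_closedArc_iff] at h3
        rintro rfl
        exact hc y ((R.mem_verts _).mpr (Or.inr h1))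
    · rintro ⟨_, ⟨a, b, h1, h2, h3⟩, rfl, rfl⟩
      refine ⟨Or.inr ⟨a, b, _, h1, h2, rfl, ?_⟩, rfl⟩
      rwa [mem_closedArc_iff]
      rintro rfl
      exact hc _ ((R.mem_verts _).mpr (Or.inr h1))
  rw [this, Set.ncard_image_of_injective]
  intro a b h
  simpa using h

lemma lonCount_eq (R : RectDiagram) (c : 𝕊) (hc : c ∉ R.pφ) :
    (lonCount (Gamma R) c : ℝ) = R.tr.len := by
  rw [mem_pφ] at hc
  rw [← R.tr.merCount_eq c hc, lonCount, merCount]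
  congr 1
  have : Gamma R.tr ∩ {p | p.1 = c} = Prod.swap '' (Gamma R ∩ {p | p.2 = c}) := by
    ext ⟨x, y⟩
    rw [Set.image_swap_eq_preimage_swap]
    simp only [Gamma, Set.mem_inter_iff, Set.mem_union, Set.mem_ofPred_eq, Set.mem_preimage,
      Prod.swap_prod_mk, mem_tr_pos, mem_tr_neg]
    apply and_congr_left
    intro _
    rw [or_comm]
    apply or_congr
    · constructor
      · rintro ⟨a, b, d, h1, h2, h3, h4⟩
        exact ⟨d, a, b, h1, h2, h3, h4⟩
      · rintro ⟨d, a, b, h1, h2, h3, h4⟩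
        exact ⟨a, b, d, h1, h2, h3, h4⟩
    · constructor
      · rintro ⟨a, b, d, h1, h2, h3, h4⟩
        exact ⟨b, d, a, h1, h2, h3, h4⟩
      · rintro ⟨b, d, a, h1, h2, h3, h4⟩
        exact ⟨a, b, d, h1, h2, h3, h4⟩
  rw [this, Set.ncard_image_of_injective _ Prod.swap_injective]

lemma isHomClass_iff (R : RectDiagram) (k l : ℕ) :
    IsHomClass R k l ↔ R.len = k ∧ R.tr.len = l := by
  constructor
  · rintro ⟨h1, h2⟩
    obtain ⟨c, -, hc⟩ := exists_generic 0 0 R.pθ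
    obtain ⟨d, -, hd⟩ := exists_generic 0 0 R.pφ
    exact ⟨by rw [← R.merCount_eq c hc, h1 c hc], by rw [← R.lonCount_eq d hd, h2 d hd]⟩
  · rintro ⟨h1, h2⟩
    refine ⟨fun c hc => ?_, fun c hc => ?_⟩
    · have := R.merCount_eq c hc
      rw [h1] at this
      exact_mod_cast this
    · have := R.lonCount_eq c hc
      rw [h2] at this
      exact_mod_cast this

end RectDiagram

open RectDiagram

/-- One-sided move of a single endpoint in a row. -/
lemma row_imp {R₁ R₂ : RectDiagram} {c y x x' : 𝕊} (hx : (x, y) ∈ R₁.verts)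
    (hx' : (x', y) ∈ R₂.verts) (hn : (x', y) ∉ R₁.verts)
    (hp : ∀ z, z ≠ x → z ≠ x' → (z, y) ∈ R₁.pos → (z, y) ∈ R₂.pos)
    (hm : ∀ z, z ≠ x → z ≠ x' → (z, y) ∈ R₁.neg → (z, y) ∈ R₂.neg)
    (hs : ∀ z, z ≠ x → z ≠ x' → (z, y) ∈ R₁.verts →
      (toIco (z - c) < toIco (x - c) → toIco (z - c) < toIco (x' - c)) ∧
      (toIco (x - c) < toIco (z - c) → toIco (x' - c) < toIco (z - c)))
    (h : R₁.Row c y) : R₂.Row c y := by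
  obtain ⟨a, b, ha, hb, hlt⟩ := h
  have hav : (a, y) ∈ R₁.verts := (R₁.mem_verts _).mpr (Or.inr ha)
  have hbv : (b, y) ∈ R₁.verts := (R₁.mem_verts _).mpr (Or.inl hb)
  have hax : a ≠ x' := by rintro rfl; exact hn hav
  have hbx : b ≠ x' := by rintro rfl; exact hn hbv
  rcases (R₁.mem_verts _).mp hx with hx | hx
  · obtain rfl := R₁.posRow hb hx
    have hab : a ≠ b := by rintro rfl; exact R₁.not_both hb ha
    have ha2 := hm a hab hax ha
    rcases (R₂.mem_verts _).mp hx' with h' | h'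
    · exact ⟨a, x', ha2, h', (hs a hab hax hav).2 hlt⟩
    · exact absurd (R₂.negRow ha2 h') hax
  · obtain rfl := R₁.negRow ha hx
    have hba : b ≠ a := by rintro rfl; exact R₁.not_both hb ha
    have hb2 := hp b hba hbx hb
    rcases (R₂.mem_verts _).mp hx' with h' | h'
    · exact absurd (R₂.posRow hb2 h') hbx
    · exact ⟨x', b, h', hb2, (hs b hba hbx hbv).1 hlt⟩

/-- The part of the data of an elementary move that is symmetric in all respects. -/
structure Mv (R₁ R₂ : RectDiagram) (θ₁ θ₂ φ₁ φ₂ : 𝕊) : Prop where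
  ht : θ₁ ≠ θ₂
  hf : φ₁ ≠ φ₂
  hpos : ∀ x y, ¬ ((x = θ₁ ∨ x = θ₂) ∧ (y = φ₁ ∨ y = φ₂)) → ((x, y) ∈ R₁.pos ↔ (x, y) ∈ R₂.pos)
  hneg : ∀ x y, ¬ ((x = θ₁ ∨ x = θ₂) ∧ (y = φ₁ ∨ y = φ₂)) → ((x, y) ∈ R₁.neg ↔ (x, y) ∈ R₂.neg)
  hcor : ∀ x y, ((x = θ₁ ∨ x = θ₂) ∧ (y = φ₁ ∨ y = φ₂)) → ((x, y) ∈ R₁.verts ↔ (x, y) ∉ R₂.verts)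
  hin : ∀ x y, (x, y) ∈ R₁.verts ∨ (x, y) ∈ R₂.verts → x ∈ closedArc θ₁ θ₂ → y ∈ closedArc φ₁ φ₂ →
    ((x = θ₁ ∨ x = θ₂) ∧ (y = φ₁ ∨ y = φ₂))

lemma Mv.symm {R₁ R₂ : RectDiagram} {θ₁ θ₂ φ₁ φ₂ : 𝕊} (h : Mv R₁ R₂ θ₁ θ₂ φ₁ φ₂) :
    Mv R₂ R₁ θ₁ θ₂ φ₁ φ₂ where
  ht := h.ht
  hf := h.hf
  hpos x y hn := (h.hpos x y hn).symm
  hneg x y hn := (h.hneg x y hn).symm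
  hcor x y hn := by have := h.hcor x y hn; tauto
  hin x y hv := h.hin x y hv.symm

lemma Mv.tr {R₁ R₂ : RectDiagram} {θ₁ θ₂ φ₁ φ₂ : 𝕊} (h : Mv R₁ R₂ θ₁ θ₂ φ₁ φ₂) :
    Mv R₁.tr R₂.tr φ₁ φ₂ θ₁ θ₂ where
  ht := h.hf
  hf := h.ht
  hpos x y hn := by
    rw [mem_tr_pos, mem_tr_pos]; exact h.hneg y x (fun hh => hn hh.symm)
  hneg x y hn := by
    rw [mem_tr_neg, mem_tr_neg]; exact h.hpos y x (fun hh => hn hh.symm)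
  hcor x y hn := by
    rw [mem_tr_verts, mem_tr_verts]; exact h.hcor y x hn.symm
  hin x y hv h1 h2 := by
    rw [mem_tr_verts, mem_tr_verts] at hv; exact (h.hin y x hv h2 h1).symm

lemma left_mem_closedArc (a b : 𝕊) : a ∈ closedArc a b := by
  simp only [closedArc, Set.mem_ofPred_eq, sub_self, toIco_zero]; exact toIco_nonneg _

lemma right_mem_closedArc (a b : 𝕊) : b ∈ closedArc a b := by
  simp only [closedArc, Set.mem_ofPred_eq, le_refl]

/-- Lengths agree if the crossing rows agree for all meridians outside the rectangle. -/
lemma len_eq_of_rows {R₁ R₂ : RectDiagram} (θ₁ θ₂ : 𝕊)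
    (h : ∀ c, c ∉ closedArc θ₁ θ₂ → ∀ y, R₁.Row c y ↔ R₂.Row c y) : R₁.len = R₂.len := by
  obtain ⟨c, hc, -⟩ := exists_generic θ₁ θ₂ ∅
  rw [R₁.len_eq c, R₂.len_eq c]
  simp_rw [h c hc]

namespace Mv
variable {R₁ R₂ : RectDiagram} {θ₁ θ₂ φ₁ φ₂ : 𝕊}

lemma row_other (h : Mv R₁ R₂ θ₁ θ₂ φ₁ φ₂) {c y : 𝕊} (h1 : y ≠ φ₁) (h2 : y ≠ φ₂) :
    R₁.Row c y ↔ R₂.Row c y := by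
  have hn : ∀ x, ¬ ((x = θ₁ ∨ x = θ₂) ∧ (y = φ₁ ∨ y = φ₂)) := by tauto
  simp only [Row]
  simp_rw [h.hpos _ _ (hn _), h.hneg _ _ (hn _)]

/-- In a row of the rectangle, an endpoint moves from `θ₂` to `θ₁`. -/
lemma row_slide (h : Mv R₁ R₂ θ₁ θ₂ φ₁ φ₂) {c y : 𝕊} (hc : c ∉ closedArc θ₁ θ₂)
    (hy : y = φ₁ ∨ y = φ₂) (h2 : (θ₂, y) ∈ R₁.verts) (h1 : (θ₁, y) ∈ R₂.verts) :
    R₁.Row c y ↔ R₂.Row c y := by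
  have hca : θ₁ ≠ c := by rintro rfl; exact hc (left_mem_closedArc _ _)
  have hy' : y ∈ closedArc φ₁ φ₂ := by
    rcases hy with rfl | rfl
    · exact left_mem_closedArc _ _
    · exact right_mem_closedArc _ _
  have n1 : (θ₁, y) ∉ R₁.verts := fun hh => (h.hcor θ₁ y ⟨Or.inl rfl, hy⟩).mp hh h1
  have n2 : (θ₂, y) ∉ R₂.verts := (h.hcor θ₂ y ⟨Or.inr rfl, hy⟩).mp h2
  have side : ∀ z, z ≠ θ₁ → z ≠ θ₂ → ((z, y) ∈ R₁.verts ∨ (z, y) ∈ R₂.verts) →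
      z ∉ closedArc θ₁ θ₂ := by
    intro z z1 z2 hz hz'
    have := h.hin z y hz hz' hy'
    tauto
  constructor
  · refine row_imp h2 h1 n1 (fun z z2 z1 => (h.hpos z y (by tauto)).mp)
      (fun z z2 z1 => (h.hneg z y (by tauto)).mp) ?_
    intro z z2 z1 hz
    obtain ⟨s1, s2⟩ := arc_side h.ht hc hca (side z z1 z2 (Or.inl hz))
    constructor <;> intro <;> rcases s2 with s2 | s2 <;> linarith
  · refine row_imp h1 h2 n2 (fun z z1 z2 => (h.hpos z y (by tauto)).mpr)
      (fun z z1 z2 => (h.hneg z y (by tauto)).mpr) ?_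
    intro z z1 z2 hz
    obtain ⟨s1, s2⟩ := arc_side h.ht hc hca (side z z1 z2 (Or.inr hz))
    constructor <;> intro <;> rcases s2 with s2 | s2 <;> linarith

/-- Exchange moving a vertical edge. -/
lemma len_V (h : Mv R₁ R₂ θ₁ θ₂ φ₁ φ₂) (h2 : (θ₂, φ₁) ∈ R₁.verts) (h3 : (θ₂, φ₂) ∈ R₁.verts)
    (h1 : (θ₁, φ₁) ∈ R₂.verts) (h4 : (θ₁, φ₂) ∈ R₂.verts) : R₁.len = R₂.len := by
  refine len_eq_of_rows θ₁ θ₂ fun c hc y => ?_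
  by_cases e1 : y = φ₁
  · subst e1; exact h.row_slide hc (Or.inl rfl) h2 h1
  by_cases e2 : y = φ₂
  · subst e2; exact h.row_slide hc (Or.inr rfl) h3 h4
  exact h.row_other e1 e2

/-- A row having two given vertices has no other vertex. -/
lemma row_two {R : RectDiagram} {a b y z : 𝕊} (hab : a ≠ b) (ha : (a, y) ∈ R.verts)
    (hb : (b, y) ∈ R.verts) (hz : (z, y) ∈ R.verts) : z = a ∨ z = b := by
  rw [mem_verts] at ha hb hz
  rcases ha with ha | ha <;> rcases hb with hb | hb <;> rcases hz with hz | hz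
  · exact Or.inl (R.posRow hz ha)
  · exact absurd (R.posRow ha hb) hab
  · exact Or.inl (R.posRow hz ha)
  · exact Or.inr (R.negRow hz hb)
  · exact Or.inr (R.posRow hz hb)
  · exact Or.inl (R.negRow hz ha)
  · exact absurd (R.negRow ha hb) hab
  · exact Or.inl (R.negRow hz ha)

/-- If `R₂` has both corners in a row of the rectangle, the row is empty in `R₁`. -/
lemma row_empty (h : Mv R₁ R₂ θ₁ θ₂ φ₁ φ₂) {y : 𝕊} (hy : y = φ₁ ∨ y = φ₂)
    (h1 : (θ₁, y) ∈ R₂.verts) (h2 : (θ₂, y) ∈ R₂.verts) (z : 𝕊) : (z, y) ∉ R₁.verts := by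
  intro hz
  by_cases e : z = θ₁ ∨ z = θ₂
  · have := (h.hcor z y ⟨e, hy⟩).mp hz
    rcases e with rfl | rfl
    · exact this h1
    · exact this h2
  · have : (z, y) ∈ R₂.verts := by
      rw [mem_verts] at hz ⊢
      rwa [← h.hpos z y (by tauto), ← h.hneg z y (by tauto)]
    exact e (row_two h.ht h1 h2 this)

lemma row_empty' {R : RectDiagram} {c y : 𝕊} (h : ∀ z, (z, y) ∉ R.verts) : ¬ R.Row c y := by
  rintro ⟨a, b, ha, hb, -⟩
  exact h a ((R.mem_verts _).mpr (Or.inr ha))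

/-- A column with one unchanged vertex: the sign is transported. -/
lemma col_sign (h : Mv R₁ R₂ θ₁ θ₂ φ₁ φ₂) {x y y' : 𝕊} (hx : x = θ₁ ∨ x = θ₂)
    (hy : y = φ₁ ∨ y = φ₂) (hy' : ∀ w, w = φ₁ ∨ w = φ₂ ↔ w = y ∨ w = y')
    (h1 : (x, y) ∈ R₁.pos) (hn : (x, y') ∉ R₁.verts) (h2 : (x, y') ∈ R₂.verts) :
    (x, y') ∈ R₂.pos := by
  obtain ⟨w, hw⟩ := (R₁.exists_theta x).mp ⟨y, h1⟩
  have w1 : w ≠ y := by rintro rfl; exact R₁.not_both h1 hw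
  have w2 : w ≠ y' := by rintro rfl; exact hn ((R₁.mem_verts _).mpr (Or.inr hw))
  have hw2 : (x, w) ∈ R₂.neg := (h.hneg x w (by have := hy' w; tauto)).mp hw
  rcases (R₂.mem_verts _).mp h2 with h2 | h2
  · exact h2
  · exact absurd (R₂.negCol hw2 h2) w2

lemma col_sign' (h : Mv R₁ R₂ θ₁ θ₂ φ₁ φ₂) {x y y' : 𝕊} (hx : x = θ₁ ∨ x = θ₂)
    (hy : y = φ₁ ∨ y = φ₂) (hy' : ∀ w, w = φ₁ ∨ w = φ₂ ↔ w = y ∨ w = y')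
    (h1 : (x, y) ∈ R₁.neg) (hn : (x, y') ∉ R₁.verts) (h2 : (x, y') ∈ R₂.verts) :
    (x, y') ∈ R₂.neg := by
  obtain ⟨w, hw⟩ := (R₁.exists_theta x).mpr ⟨y, h1⟩
  have w1 : w ≠ y := by rintro rfl; exact R₁.not_both hw h1
  have w2 : w ≠ y' := by rintro rfl; exact hn ((R₁.mem_verts _).mpr (Or.inl hw))
  have hw2 : (x, w) ∈ R₂.pos := (h.hpos x w (by have := hy' w; tauto)).mp hw
  rcases (R₂.mem_verts _).mp h2 with h2 | h2
  · exact absurd (R₂.posCol hw2 h2) w2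
  · exact h2

lemma row_jump (h : Mv R₁ R₂ θ₁ θ₂ φ₁ φ₂) {c y y' : 𝕊}
    (hy : y = φ₁ ∨ y = φ₂) (hy' : ∀ w, w = φ₁ ∨ w = φ₂ ↔ w = y ∨ w = y')
    (h1 : (θ₁, y) ∈ R₁.verts) (h2 : (θ₂, y) ∈ R₁.verts)
    (h4 : (θ₁, y') ∈ R₂.verts) (h3 : (θ₂, y') ∈ R₂.verts) (hr : R₁.Row c y) : R₂.Row c y' := by
  have em := h.row_empty ((hy' y').mpr (Or.inr rfl)) h4 h3
  obtain ⟨a, b, ha, hb, hlt⟩ := hr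
  have ea : a = θ₁ ∨ a = θ₂ := row_two h.ht h1 h2 ((R₁.mem_verts _).mpr (Or.inr ha))
  have eb : b = θ₁ ∨ b = θ₂ := row_two h.ht h1 h2 ((R₁.mem_verts _).mpr (Or.inl hb))
  refine ⟨a, b, h.col_sign' ea hy hy' ha (em a) ?_, h.col_sign eb hy hy' hb (em b) ?_, hlt⟩
  · rcases ea with rfl | rfl <;> assumption
  · rcases eb with rfl | rfl <;> assumption

/-- Exchange moving a horizontal edge. -/
lemma len_H (h : Mv R₁ R₂ θ₁ θ₂ φ₁ φ₂) (h1 : (θ₁, φ₁) ∈ R₁.verts) (h2 : (θ₂, φ₁) ∈ R₁.verts)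
    (h4 : (θ₁, φ₂) ∈ R₂.verts) (h3 : (θ₂, φ₂) ∈ R₂.verts) : R₁.len = R₂.len := by
  classical
  obtain ⟨c, hc, -⟩ := exists_generic θ₁ θ₂ ∅
  rw [R₁.len_eq c, R₂.len_eq c]
  have key : ∀ y, R₂.Row c (Equiv.swap φ₁ φ₂ y) ↔ R₁.Row c y := by
    intro y
    by_cases e1 : y = φ₁
    · subst e1
      rw [Equiv.swap_apply_left]
      exact ⟨h.symm.row_jump (Or.inr rfl) (fun w => or_comm) h4 h3 h1 h2,
        h.row_jump (Or.inl rfl) (fun w => Iff.rfl) h1 h2 h4 h3⟩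
    by_cases e2 : y = φ₂
    · subst e2
      rw [Equiv.swap_apply_right]
      exact iff_of_false (row_empty' (h.symm.row_empty (Or.inl rfl) h1 h2))
        (row_empty' (h.row_empty (Or.inr rfl) h4 h3))
    rw [Equiv.swap_apply_of_ne_of_ne e1 e2]
    exact (h.row_other e1 e2).symm
  have : {y | R₂.Row c y} = Equiv.swap φ₁ φ₂ '' {y | R₁.Row c y} := by
    ext y
    rw [Equiv.image_eq_preimage_symm, Equiv.symm_swap]
    simp only [Set.mem_ofPred_eq, Set.mem_preimage]
    rw [← key, Equiv.swap_apply_self]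
  rw [this, Set.ncard_image_of_injective _ (Equiv.injective _)]

/-- The new short edge does not cross meridians outside the rectangle. -/
lemma short_row {R : RectDiagram} {c y : 𝕊} (ht : θ₁ ≠ θ₂) (hc : c ∉ closedArc θ₁ θ₂)
    (h1 : (θ₁, y) ∈ R.neg) (h2 : (θ₂, y) ∈ R.pos) : ¬ R.Row c y := by
  rintro ⟨a, b, ha, hb, hlt⟩
  obtain rfl := R.negRow ha h1
  obtain rfl := R.posRow hb h2
  rw [mem_closedArc_iff] at hc
  · exact hc hlt
  · rintro rfl; exact hc (left_mem_closedArc _ _)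

/-- Stabilization at the upper left corner. -/
lemma len_S4 (h : Mv R₁ R₂ θ₁ θ₂ φ₁ φ₂) (h4 : (θ₁, φ₂) ∈ R₁.verts) (h1 : (θ₁, φ₁) ∈ R₂.neg)
    (h2 : (θ₂, φ₁) ∈ R₂.pos) (h3 : (θ₂, φ₂) ∈ R₂.neg) : R₁.len = R₂.len := by
  refine len_eq_of_rows θ₁ θ₂ fun c hc y => ?_
  by_cases e1 : y = φ₁
  · subst e1
    exact iff_of_false (row_empty' (h.row_empty (Or.inl rfl) ((R₂.mem_verts _).mpr (Or.inr h1))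
      ((R₂.mem_verts _).mpr (Or.inl h2)))) (short_row h.ht hc h1 h2)
  by_cases e2 : y = φ₂
  · subst e2
    exact (h.symm.row_slide hc (Or.inr rfl) ((R₂.mem_verts _).mpr (Or.inr h3)) h4).symm
  exact h.row_other e1 e2

/-- Stabilization at the lower right corner. -/
lemma len_S2 (h : Mv R₁ R₂ θ₁ θ₂ φ₁ φ₂) (h2 : (θ₂, φ₁) ∈ R₁.verts) (h1 : (θ₁, φ₁) ∈ R₂.pos)
    (h4 : (θ₁, φ₂) ∈ R₂.neg) (h3 : (θ₂, φ₂) ∈ R₂.pos) : R₁.len = R₂.len := by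
  refine len_eq_of_rows θ₁ θ₂ fun c hc y => ?_
  by_cases e2 : y = φ₂
  · subst e2
    exact iff_of_false (row_empty' (h.row_empty (Or.inr rfl) ((R₂.mem_verts _).mpr (Or.inr h4))
      ((R₂.mem_verts _).mpr (Or.inl h3)))) (short_row h.ht hc h4 h3)
  by_cases e1 : y = φ₁
  · subst e1
    exact h.row_slide hc (Or.inl rfl) h2 ((R₂.mem_verts _).mpr (Or.inl h1))
  exact h.row_other e1 e2

end Mv

lemma mv_of_data {R₁ R₂ : RectDiagram} {θ₁ θ₂ φ₁ φ₂ : 𝕊} (h : ElemMoveData R₁ R₂ θ₁ θ₂ φ₁ φ₂) :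
    Mv R₁ R₂ θ₁ θ₂ φ₁ φ₂ := by
  obtain ⟨ht, hf, hsd, hin, -, hsg⟩ := h
  rw [hsd] at hin
  have hsd' : ∀ x y, (((x, y) ∈ R₁.verts ∧ (x, y) ∉ R₂.verts) ∨
      ((x, y) ∈ R₂.verts ∧ (x, y) ∉ R₁.verts)) ↔
      ((x = θ₁ ∨ x = θ₂) ∧ (y = φ₁ ∨ y = φ₂)) := by
    intro x y
    have := Set.ext_iff.mp hsd (x, y)
    simpa [Set.mem_symmDiff] using this
  have hin' : ∀ x y, ((x ∈ closedArc θ₁ θ₂ ∧ y ∈ closedArc φ₁ φ₂) ∧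
      ((x, y) ∈ R₁.verts ∨ (x, y) ∈ R₂.verts)) ↔
      ((x = θ₁ ∨ x = θ₂) ∧ (y = φ₁ ∨ y = φ₂)) := by
    intro x y
    have := Set.ext_iff.mp hin (x, y)
    simpa using this
  have hsg' : ∀ x y, ((x, y) ∈ R₁.pos ∧ (x, y) ∈ R₂.verts) ↔
      ((x, y) ∈ R₁.verts ∧ (x, y) ∈ R₂.pos) := by
    intro x y
    have := Set.ext_iff.mp hsg (x, y)
    simpa using this
  refine ⟨ht, hf, ?_, ?_, ?_, ?_⟩
  · intro x y hn
    have h1 := hsd' x y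
    have h2 := hsg' x y
    have h3 := R₁.mem_verts (x, y)
    have h4 := R₂.mem_verts (x, y)
    grind
  · intro x y hn
    have h1 := hsd' x y
    have h2 := hsg' x y
    have h3 := R₁.mem_verts (x, y)
    have h4 := R₂.mem_verts (x, y)
    have h5 := R₁.not_both (p := (x, y))
    have h6 := R₂.not_both (p := (x, y))
    grind
  · intro x y hn
    have h1 := hsd' x y
    grind
  · intro x y hv hx hy
    exact (hin' x y).mp ⟨⟨hx, hy⟩, hv⟩

open Classical in
/-- Counting the corners. -/
lemma Mv.card_eq {R₁ R₂ : RectDiagram} {θ₁ θ₂ φ₁ φ₂ : 𝕊} (h : Mv R₁ R₂ θ₁ θ₂ φ₁ φ₂) :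
    R₂.verts.card + ((if (θ₁, φ₁) ∈ R₁.verts then 1 else 0) +
      (if (θ₂, φ₁) ∈ R₁.verts then 1 else 0) + (if (θ₂, φ₂) ∈ R₁.verts then 1 else 0) +
      (if (θ₁, φ₂) ∈ R₁.verts then 1 else 0)) =
    R₁.verts.card + ((if (θ₁, φ₁) ∈ R₁.verts then 0 else 1) +
      (if (θ₂, φ₁) ∈ R₁.verts then 0 else 1) + (if (θ₂, φ₂) ∈ R₁.verts then 0 else 1) +
      (if (θ₁, φ₂) ∈ R₁.verts then 0 else 1)) := by
  set E : Finset Torus := {(θ₁, φ₁), (θ₂, φ₁), (θ₂, φ₂), (θ₁, φ₂)} with hE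
  have memE : ∀ x y, (x, y) ∈ E ↔ ((x = θ₁ ∨ x = θ₂) ∧ (y = φ₁ ∨ y = φ₂)) := by
    intro x y
    simp only [hE, Finset.mem_insert, Finset.mem_singleton, Prod.mk.injEq]
    tauto
  have same : ∀ x y, (x, y) ∉ E → ((x, y) ∈ R₁.verts ↔ (x, y) ∈ R₂.verts) := by
    intro x y hn
    rw [memE] at hn
    rw [mem_verts, mem_verts, h.hpos x y hn, h.hneg x y hn]
  have cor : ∀ x y, (x, y) ∈ E → ((x, y) ∈ R₁.verts ↔ (x, y) ∉ R₂.verts) := by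
    intro x y hn
    exact h.hcor x y ((memE x y).mp hn)
  have f1 : R₁.verts \ R₂.verts = E.filter (fun p => p ∈ R₁.verts) := by
    ext ⟨x, y⟩
    have := same x y
    have := cor x y
    simp only [Finset.mem_sdiff, Finset.mem_filter]
    tauto
  have f2 : R₂.verts \ R₁.verts = E.filter (fun p => ¬ p ∈ R₁.verts) := by
    ext ⟨x, y⟩
    have := same x y
    have := cor x y
    simp only [Finset.mem_sdiff, Finset.mem_filter]
    tauto
  have k1 := Finset.card_sdiff_add_card_inter R₁.verts R₂.verts
  have k2 := Finset.card_sdiff_add_card_inter R₂.verts R₁.verts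
  rw [Finset.inter_comm] at k2
  have sumE : ∀ g : Torus → ℕ, ∑ p ∈ E, g p =
      g (θ₁, φ₁) + g (θ₂, φ₁) + g (θ₂, φ₂) + g (θ₁, φ₂) := by
    intro g
    have ht := h.ht
    have hf := h.hf
    rw [hE, Finset.sum_insert, Finset.sum_insert, Finset.sum_insert, Finset.sum_singleton]
    · ring
    all_goals simp [ht, hf, ht.symm, hf.symm]
  rw [f1, Finset.card_filter, sumE] at k1
  rw [f2, Finset.card_filter, sumE] at k2
  simp only [ite_not] at k2
  omega

/-- Both lengths agree. -/
def SameLen (R₁ R₂ : RectDiagram) : Prop := R₁.len = R₂.len ∧ R₁.tr.len = R₂.tr.len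

lemma sameLen_exchange {R₁ R₂ : RectDiagram} (h : ExchangeMove R₁ R₂) : SameLen R₁ R₂ := by
  obtain ⟨⟨θ₁, θ₂, φ₁, φ₂, hd⟩, hcard⟩ := h
  have h := mv_of_data hd
  obtain ⟨-, -, -, -, ⟨s, hs, hs', -⟩, -⟩ := hd
  have ht := h.ht
  have hf := h.hf
  have m1 : (θ₁, φ₁) ∈ R₁.verts ↔ (θ₁, φ₁) ∈ s := by rw [← hs']; simp
  have m2 : (θ₂, φ₁) ∈ R₁.verts ↔ (θ₂, φ₁) ∈ s := by rw [← hs']; simp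
  have m3 : (θ₂, φ₂) ∈ R₁.verts ↔ (θ₂, φ₂) ∈ s := by rw [← hs']; simp
  have m4 : (θ₁, φ₂) ∈ R₁.verts ↔ (θ₁, φ₂) ∈ s := by rw [← hs']; simp
  have c1 := h.hcor θ₁ φ₁ (by simp)
  have c2 := h.hcor θ₂ φ₁ (by simp)
  have c3 := h.hcor θ₂ φ₂ (by simp)
  have c4 := h.hcor θ₁ φ₂ (by simp)
  have hk := h.card_eq
  rw [hcard] at hk
  have hV : ∀ {S₁ S₂ : RectDiagram}, Mv S₁ S₂ θ₁ θ₂ φ₁ φ₂ → (θ₂, φ₁) ∈ S₁.verts →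
      (θ₂, φ₂) ∈ S₁.verts → (θ₁, φ₁) ∈ S₂.verts → (θ₁, φ₂) ∈ S₂.verts → SameLen S₁ S₂ := by
    intro S₁ S₂ g g2 g3 g1 g4
    refine ⟨g.len_V g2 g3 g1 g4, (g.symm.tr.len_H ?_ ?_ ?_ ?_).symm⟩ <;>
      rw [mem_tr_verts] <;> assumption
  have hH : ∀ {S₁ S₂ : RectDiagram}, Mv S₁ S₂ θ₁ θ₂ φ₁ φ₂ → (θ₁, φ₁) ∈ S₁.verts →
      (θ₂, φ₁) ∈ S₁.verts → (θ₁, φ₂) ∈ S₂.verts → (θ₂, φ₂) ∈ S₂.verts → SameLen S₁ S₂ := by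
    intro S₁ S₂ g g1 g2 g4 g3
    refine ⟨g.len_H g1 g2 g4 g3, (g.symm.tr.len_V ?_ ?_ ?_ ?_).symm⟩ <;>
      rw [mem_tr_verts] <;> assumption
  simp only [ConsecCorners] at hs
  rcases hs with e | e | e | e | e | e | e | e | e | e | e | e <;>
    simp [e, ht, hf, ht.symm, hf.symm] at m1 m2 m3 m4 <;>
    simp [m1, m2, m3, m4] at hk c1 c2 c3 c4
  · exact hH h m1 m2 c4 c3
  · exact hV h m2 m3 c1 c4
  · have := hH h.symm c1 c2 m4 m3
    exact ⟨this.1.symm, this.2.symm⟩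
  · have := hV h.symm c2 c3 m1 m4
    exact ⟨this.1.symm, this.2.symm⟩

lemma sameLen_stab {R₁ R₂ : RectDiagram} {θ₁ θ₂ φ₁ φ₂ : 𝕊} (h : Mv R₁ R₂ θ₁ θ₂ φ₁ φ₂)
    (hcard : R₂.verts.card = R₁.verts.card + 2) (hT : StabTypeData R₁ R₂ θ₁ θ₂ φ₁ φ₂ .rII) :
    SameLen R₁ R₂ := by
  obtain ⟨v, ⟨hv, -⟩, φ₀, hφ₀, hp1, hp2, hvv, hpos⟩ := hT
  have ht := h.ht
  have hf := h.hf
  have c1 := h.hcor θ₁ φ₁ (by simp)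
  have c2 := h.hcor θ₂ φ₁ (by simp)
  have c3 := h.hcor θ₂ φ₂ (by simp)
  have c4 := h.hcor θ₁ φ₂ (by simp)
  have hk := h.card_eq
  rw [hcard] at hk
  rw [Finset.mem_coe] at hv
  rcases hvv with rfl | rfl
  · rw [if_pos hv, if_pos hv] at hk
    have n1 : (θ₁, φ₁) ∉ R₁.verts := by
      intro hh
      rw [if_pos hh, if_pos hh] at hk
      split_ifs at hk <;> omega
    have n2 : (θ₂, φ₁) ∉ R₁.verts := by
      intro hh
      rw [if_pos hh, if_pos hh] at hk
      split_ifs at hk <;> omega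
    have n3 : (θ₂, φ₂) ∉ R₁.verts := by
      intro hh
      rw [if_pos hh, if_pos hh] at hk
      split_ifs at hk <;> omega
    have e : φ₀ = φ₁ := by
      rcases hφ₀ with e | e
      · exact e
      · rw [Set.mem_singleton_iff] at e
        subst e
        exact absurd hp1 (c4.mp hv)
    subst e
    have g1 : (θ₁, φ₀) ∈ R₂.neg := by
      rcases (R₂.mem_verts _).mp hp1 with g | g
      · exact absurd (R₂.posRow g hpos) ht
      · exact g
    have g3 : (θ₂, φ₂) ∈ R₂.neg := by
      have : (θ₂, φ₂) ∈ R₂.verts := by tauto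
      rcases (R₂.mem_verts _).mp this with g | g
      · exact absurd (R₂.posCol hpos g) hf
      · exact g
    refine ⟨h.len_S4 hv g1 hpos g3, h.tr.len_S2 ?_ ?_ ?_ ?_⟩
    · rwa [mem_tr_verts]
    · rwa [mem_tr_pos]
    · rwa [mem_tr_neg]
    · rwa [mem_tr_pos]
  · rw [if_pos hv, if_pos hv] at hk
    have n1 : (θ₁, φ₁) ∉ R₁.verts := by
      intro hh
      rw [if_pos hh, if_pos hh] at hk
      split_ifs at hk <;> omega
    have n3 : (θ₂, φ₂) ∉ R₁.verts := by
      intro hh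
      rw [if_pos hh, if_pos hh] at hk
      split_ifs at hk <;> omega
    have n4 : (θ₁, φ₂) ∉ R₁.verts := by
      intro hh
      rw [if_pos hh, if_pos hh] at hk
      split_ifs at hk <;> omega
    have e : φ₀ = φ₂ := by
      rcases hφ₀ with e | e
      · subst e
        exact absurd hp2 (c2.mp hv)
      · exact e
    subst e
    have g4 : (θ₁, φ₀) ∈ R₂.neg := by
      rcases (R₂.mem_verts _).mp hp1 with g | g
      · exact absurd (R₂.posRow g hpos) ht
      · exact g
    have g1 : (θ₁, φ₁) ∈ R₂.pos := by
      have : (θ₁, φ₁) ∈ R₂.verts := by tauto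
      rcases (R₂.mem_verts _).mp this with g | g
      · exact g
      · exact absurd (R₂.negCol g g4) hf
    refine ⟨h.len_S2 hv g1 g4 hpos, h.tr.len_S4 ?_ ?_ ?_ ?_⟩
    · rwa [mem_tr_verts]
    · rwa [mem_tr_neg]
    · rwa [mem_tr_pos]
    · rwa [mem_tr_neg]

/-- an exchange move or a type `→II` stabilization or destabilization
preserves the homology class of `Γ_→II` in `H₁(T²;ℤ)`. -/
theorem stmt8 (R₁ R₂ : RectDiagram)
    (h : ExchangeMove R₁ R₂ ∨ StabOfType R₁ R₂ .rII ∨ DestabOfType R₁ R₂ .rII)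
    (k l : ℕ) :
    IsHomClass R₁ k l ↔ IsHomClass R₂ k l := by
  have hS : SameLen R₁ R₂ := by
    rcases h with h | ⟨θ₁, θ₂, φ₁, φ₂, hd, hc, hT⟩ | ⟨θ₁, θ₂, φ₁, φ₂, hd, hc, hT⟩
    · exact sameLen_exchange h
    · exact sameLen_stab (mv_of_data hd) hc hT
    · have := sameLen_stab (mv_of_data hd).symm hc hT
      exact ⟨this.1.symm, this.2.symm⟩
  rw [R₁.isHomClass_iff, R₂.isHomClass_iff, hS.1, hS.2]

end
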